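/- Let D be a connected digraph. Then the dichromatic number of D satisfies χ⃗(D) ≤ max{max(d⁺(v), d⁻(v)) : v ∈ V(D)} + 1, and equality holds if and only if D is a directed cycle, a bidirected odd cycle, or a bidirected complete graph. -/

import Mathlib

open scoped Classical

/-- A finite digraph with vertex set a `Finset ℕ` and no loops.
Both arcs `(u,v)` and `(v,u)` may be present (a digon). -/
structure Digraph' where
  verts : Finset ℕ
  arcs : Finset (ℕ × ℕ)
  mem_fst : ∀ a ∈ arcs, a.1 ∈ verts
  mem_snd : ∀ a ∈ arcs, a.2 ∈ verts
  no_loops : ∀ a ∈ arcs, a.1 ≠ a.2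

namespace Digraph'

/-- In-degree of `v`. -/
def inDeg (D : Digraph') (v : ℕ) : ℕ := (D.arcs.filter fun a => a.2 = v).card

/-- Out-degree of `v`. -/
def outDeg (D : Digraph') (v : ℕ) : ℕ := (D.arcs.filter fun a => a.1 = v).card

/-- In-neighbourhood of `v`. -/
def inNbrs (D : Digraph') (v : ℕ) : Finset ℕ := (D.arcs.filter fun a => a.2 = v).image Prod.fst

/-- Out-neighbourhood of `v`. -/
def outNbrs (D : Digraph') (v : ℕ) : Finset ℕ := (D.arcs.filter fun a => a.1 = v).image Prod.snd

/-- Neighbourhood of `v` in the underlying graph. -/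
def ugNbrs (D : Digraph') (v : ℕ) : Finset ℕ := D.inNbrs v ∪ D.outNbrs v

/-- `H` is a subdigraph of `D`. -/
def IsSubdigraph (H D : Digraph') : Prop := H.verts ⊆ D.verts ∧ H.arcs ⊆ D.arcs

/-- The subdigraph of `D` induced by the vertex set `X`. -/
def induce (D : Digraph') (X : Finset ℕ) : Digraph' where
  verts := D.verts ∩ X
  arcs := D.arcs.filter fun a => a.1 ∈ X ∧ a.2 ∈ X
  mem_fst := fun a ha => by
    simp only [Finset.mem_filter] at ha
    exact Finset.mem_inter.mpr ⟨D.mem_fst a ha.1, ha.2.1⟩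
  mem_snd := fun a ha => by
    simp only [Finset.mem_filter] at ha
    exact Finset.mem_inter.mpr ⟨D.mem_snd a ha.1, ha.2.2⟩
  no_loops := fun a ha => by
    simp only [Finset.mem_filter] at ha
    exact D.no_loops a ha.1

/-- `D − X`, the digraph obtained from `D` by deleting the vertices of `X`. -/
def del (D : Digraph') (X : Finset ℕ) : Digraph' := D.induce (D.verts \ X)

/-- Adjacency in the underlying graph of `D`. -/
def ugAdj (D : Digraph') (u v : ℕ) : Prop :=
  u ∈ D.verts ∧ v ∈ D.verts ∧ ((u, v) ∈ D.arcs ∨ (v, u) ∈ D.arcs)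

/-- `D` is connected, i.e. its underlying graph is connected. -/
def Connected (D : Digraph') : Prop :=
  D.verts.Nonempty ∧ ∀ u ∈ D.verts, ∀ v ∈ D.verts, Relation.ReflTransGen D.ugAdj u v

/-- `D` is biconnected: it has at least two vertices, is connected, and stays
connected after the deletion of any vertex. -/
def Biconnected (D : Digraph') : Prop :=
  2 ≤ D.verts.card ∧ D.Connected ∧ ∀ x ∈ D.verts, (D.del {x}).Connected

/-- Every arc of `D` lies in a digon. -/
def Bidirected (D : Digraph') : Prop := ∀ a ∈ D.arcs, (a.2, a.1) ∈ D.arcs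

/-- The underlying graph of `D` is a cycle. -/
def IsCycleUG (D : Digraph') : Prop :=
  D.Connected ∧ ∀ v ∈ D.verts, (D.ugNbrs v).card = 2

/-- `D` is a bidirected odd cycle. -/
def BidirectedOddCycle (D : Digraph') : Prop :=
  D.Bidirected ∧ D.IsCycleUG ∧ Odd D.verts.card

/-- `D` is a bidirected complete graph. -/
def BidirectedComplete (D : Digraph') : Prop :=
  ∀ u ∈ D.verts, ∀ v ∈ D.verts, u ≠ v → (u, v) ∈ D.arcs

/-- `D` is strictly-`f`-bidegenerate: every nonempty subdigraph `H` of `D` contains a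
vertex `v` with `d⁻_H(v) < f⁻(v)` or `d⁺_H(v) < f⁺(v)`. -/
def StrictlyBidegenerate (D : Digraph') (f : ℕ → ℕ × ℕ) : Prop :=
  ∀ H : Digraph', H.IsSubdigraph D → H.verts.Nonempty →
    ∃ v ∈ H.verts, H.inDeg v < (f v).1 ∨ H.outDeg v < (f v).2

/-- `α` is an `F`-dicolouring of `D`: for each colour `i`, the subdigraph induced by the
vertices coloured `i` is strictly-`Fᵢ`-bidegenerate. -/
def IsDicolouring (D : Digraph') (s : ℕ) (F : Fin s → ℕ → ℕ × ℕ) (α : ℕ → Fin s) : Prop :=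
  ∀ i : Fin s, (D.induce (D.verts.filter fun v => α v = i)).StrictlyBidegenerate (F i)

/-- `D` is `F`-dicolourable. -/
def Dicolourable (D : Digraph') (s : ℕ) (F : Fin s → ℕ → ℕ × ℕ) : Prop :=
  ∃ α : ℕ → Fin s, D.IsDicolouring s F α

/-- `(D,F)` is a valid pair: `D` is connected and the colour budget dominates the
in- and out-degrees at every vertex. -/
def ValidPair (D : Digraph') (s : ℕ) (F : Fin s → ℕ → ℕ × ℕ) : Prop :=
  D.Connected ∧ ∀ v ∈ D.verts,
    D.inDeg v ≤ ∑ i, (F i v).1 ∧ D.outDeg v ≤ ∑ i, (F i v).2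

/-- `(D,F)` is tight: both budget inequalities are equalities at every vertex. -/
def Tight (D : Digraph') (s : ℕ) (F : Fin s → ℕ → ℕ × ℕ) : Prop :=
  ∀ v ∈ D.verts, ∑ i, (F i v).1 = D.inDeg v ∧ ∑ i, (F i v).2 = D.outDeg v

/-- Hard pairs, defined inductively: monochromatic, bicycle, complete, and join hard pairs. -/
inductive IsHardPair : (s : ℕ) → Digraph' → (Fin s → ℕ → ℕ × ℕ) → Prop
  | mono {s : ℕ} {D : Digraph'} {F : Fin s → ℕ → ℕ × ℕ} (i : Fin s)
      (hbi : D.Biconnected)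
      (hi : ∀ v ∈ D.verts, F i v = (D.inDeg v, D.outDeg v))
      (hk : ∀ k : Fin s, k ≠ i → ∀ v ∈ D.verts, F k v = (0, 0)) :
      IsHardPair s D F
  | bicycle {s : ℕ} {D : Digraph'} {F : Fin s → ℕ → ℕ × ℕ} (i j : Fin s) (hij : i ≠ j)
      (hD : D.BidirectedOddCycle)
      (hi : ∀ v ∈ D.verts, F i v = (1, 1))
      (hj : ∀ v ∈ D.verts, F j v = (1, 1))
      (hk : ∀ k : Fin s, k ≠ i → k ≠ j → ∀ v ∈ D.verts, F k v = (0, 0)) :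
      IsHardPair s D F
  | complete {s : ℕ} {D : Digraph'} {F : Fin s → ℕ → ℕ × ℕ}
      (hD : D.BidirectedComplete)
      (hconst : ∀ k : Fin s, ∀ u ∈ D.verts, ∀ v ∈ D.verts, F k u = F k v)
      (hsym : ∀ k : Fin s, ∀ v ∈ D.verts, (F k v).1 = (F k v).2)
      (hsum : ∀ v ∈ D.verts, ∑ k, (F k v).2 = D.verts.card - 1) :
      IsHardPair s D F
  | join {s : ℕ} {D : Digraph'} {F : Fin s → ℕ → ℕ × ℕ}
      (D₁ D₂ : Digraph') (F₁ F₂ : Fin s → ℕ → ℕ × ℕ) (x : ℕ)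
      (h₁ : IsHardPair s D₁ F₁) (h₂ : IsHardPair s D₂ F₂)
      (hx : D₁.verts ∩ D₂.verts = {x})
      (hV : D.verts = D₁.verts ∪ D₂.verts)
      (hA : D.arcs = D₁.arcs ∪ D₂.arcs)
      (hF₁ : ∀ k : Fin s, ∀ v ∈ D₁.verts, v ≠ x → F k v = F₁ k v)
      (hF₂ : ∀ k : Fin s, ∀ v ∈ D₂.verts, v ≠ x → F k v = F₂ k v)
      (hFx : ∀ k : Fin s, F k x = ((F₁ k x).1 + (F₂ k x).1, (F₁ k x).2 + (F₂ k x).2)) :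
      IsHardPair s D F

/-- The sequence of functions of the pair reduced from `(D,F)` by a colouring `α` of
`X ⊆ V(D)`: the budget of colour `i` at `u` decreases by the number of in- and out-neighbours
of `u` inside `X` coloured `i` (truncated at `0`). -/
def reduceF (D : Digraph') {s : ℕ} (F : Fin s → ℕ → ℕ × ℕ) (X : Finset ℕ) (α : ℕ → Fin s) :
    Fin s → ℕ → ℕ × ℕ :=
  fun i u =>
    ((F i u).1 - ((D.inNbrs u ∩ X).filter fun w => α w = i).card,
     (F i u).2 - ((D.outNbrs u ∩ X).filter fun w => α w = i).card)

/-- `B` is a block of `D`: a maximal biconnected subdigraph. -/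
def IsBlock (B D : Digraph') : Prop :=
  B.IsSubdigraph D ∧ B.Biconnected ∧
    ∀ B' : Digraph', B'.IsSubdigraph D → B'.Biconnected → B.IsSubdigraph B' → B' = B

/-- `x` is a cut-vertex of `D`: `D − x` is disconnected. -/
def CutVertex (D : Digraph') (x : ℕ) : Prop :=
  x ∈ D.verts ∧ (D.del {x}).verts.Nonempty ∧ ¬ (D.del {x}).Connected

/-- `B` is an end-block of `D` whose unique cut-vertex (of `D`) in `B` is `x`. -/
def IsEndBlockAt (B D : Digraph') (x : ℕ) : Prop :=
  IsBlock B D ∧ x ∈ B.verts ∧ D.CutVertex x ∧ ∀ y ∈ B.verts, D.CutVertex y → y = x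

/-- `B` is a monochromatic hard end-block with cut-vertex `x`, for colour `c`. -/
def MonoHardEndBlock {s : ℕ} (F : Fin s → ℕ → ℕ × ℕ) (B : Digraph') (x : ℕ) (c : Fin s) : Prop :=
  B.inDeg x ≤ (F c x).1 ∧ B.outDeg x ≤ (F c x).2 ∧
    ∀ v ∈ B.verts, v ≠ x →
      F c v = (B.inDeg v, B.outDeg v) ∧ ∀ k : Fin s, k ≠ c → F k v = (0, 0)

/-- `B` is a bicycle hard end-block with cut-vertex `x`. -/
def BicycleHardEndBlock {s : ℕ} (F : Fin s → ℕ → ℕ × ℕ) (B : Digraph') (x : ℕ) : Prop :=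
  B.BidirectedOddCycle ∧
    ∃ i j : Fin s, i ≠ j ∧
      1 ≤ (F i x).1 ∧ 1 ≤ (F i x).2 ∧ 1 ≤ (F j x).1 ∧ 1 ≤ (F j x).2 ∧
      ∀ v ∈ B.verts, v ≠ x →
        F i v = (1, 1) ∧ F j v = (1, 1) ∧ ∀ k : Fin s, k ≠ i → k ≠ j → F k v = (0, 0)

/-- `B` is a complete hard end-block with cut-vertex `x`. -/
def CompleteHardEndBlock {s : ℕ} (F : Fin s → ℕ → ℕ × ℕ) (B : Digraph') (x : ℕ) : Prop :=
  B.BidirectedComplete ∧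
    (∀ k : Fin s, ∀ u ∈ B.verts, u ≠ x → ∀ v ∈ B.verts, v ≠ x → F k u = F k v) ∧
    (∀ k : Fin s, ∀ v ∈ B.verts, v ≠ x → (F k v).1 = (F k v).2) ∧
    (∀ k : Fin s, ∀ u ∈ B.verts, u ≠ x → (F k u).1 ≤ (F k x).1 ∧ (F k u).2 ≤ (F k x).2)

/-- `B` is a hard end-block with cut-vertex `x`. -/
def HardEndBlock {s : ℕ} (F : Fin s → ℕ → ℕ × ℕ) (B : Digraph') (x : ℕ) : Prop :=
  (∃ c : Fin s, MonoHardEndBlock F B x c) ∨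
    BicycleHardEndBlock F B x ∨ CompleteHardEndBlock F B x

/-- `(D',F')` is the contraction of `(D,F)` with respect to the hard end-block `B` with
cut-vertex `x`, where `u` is a vertex of `B` other than `x`. -/
def IsContraction (D : Digraph') {s : ℕ} (F : Fin s → ℕ → ℕ × ℕ) (B : Digraph') (x u : ℕ)
    (D' : Digraph') (F' : Fin s → ℕ → ℕ × ℕ) : Prop :=
  D' = D.del (B.verts \ {x}) ∧
  (∀ k : Fin s, ∀ v ∈ D'.verts, v ≠ x → F' k v = F k v) ∧
  ((∃ c : Fin s, MonoHardEndBlock F B x c ∧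
      F' c x = ((F c x).1 - B.inDeg x, (F c x).2 - B.outDeg x) ∧
      ∀ k : Fin s, k ≠ c → F' k x = F k x) ∨
   ((¬ ∃ c : Fin s, MonoHardEndBlock F B x c) ∧
      ∀ k : Fin s, F' k x = ((F k x).1 - (F k u).1, (F k x).2 - (F k u).2)))

/-- Property (E): all the functions exceed `1` in the relevant coordinate at every vertex
having an in-(resp. out-)neighbour. -/
def PropE (D : Digraph') {s : ℕ} (F : Fin s → ℕ → ℕ × ℕ) : Prop :=
  ∀ x ∈ D.verts, ∀ c : Fin s,
    (0 < D.inDeg x → 1 ≤ (F c x).1) ∧ (0 < D.outDeg x → 1 ≤ (F c x).2)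

/-- `C` is a directed cycle: connected, and every vertex has in- and out-degree one. -/
def IsDirectedCycle (C : Digraph') : Prop :=
  C.Connected ∧ ∀ v ∈ C.verts, C.inDeg v = 1 ∧ C.outDeg v = 1

/-- `D` is acyclic: it contains no directed cycle. -/
def AcyclicD (D : Digraph') : Prop :=
  ¬ ∃ C : Digraph', C.IsSubdigraph D ∧ C.IsDirectedCycle

/-- `α` is a `k`-dicolouring of `D`: every colour class induces an acyclic subdigraph. -/
def IsKDicolouring (D : Digraph') (k : ℕ) (α : ℕ → Fin k) : Prop :=
  ∀ i : Fin k, AcyclicD (D.induce (D.verts.filter fun v => α v = i))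

/-- The dichromatic number of `D`. -/
noncomputable def dichromatic (D : Digraph') : ℕ :=
  sInf {k : ℕ | ∃ α : ℕ → Fin k, D.IsKDicolouring k α}

end Digraph'

open Digraph'

namespace DirectedBrooks

variable {W : Type} {A : W → W → Prop} {k : ℕ}

/-- Adjacency in the underlying graph of the digraph with arc relation `A`. -/
def Adj (A : W → W → Prop) (u v : W) : Prop := A u v ∨ A v u

/-- Every nonempty `T ⊆ S` contains a source or a sink of the digraph induced by `T`;
for finite digraphs this means that `S` induces an acyclic digraph. -/
def Acyc (A : W → W → Prop) (S : Set W) : Prop :=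
  ∀ T ⊆ S, T.Nonempty → ∃ v ∈ T, (∀ w ∈ T, ¬ A w v) ∨ (∀ w ∈ T, ¬ A v w)

/-- `α` restricted to `X` is a dicolouring of the digraph induced by `X`. -/
def Col (A : W → W → Prop) (X : Set W) (α : W → Fin k) : Prop :=
  ∀ i, Acyc A {x | x ∈ X ∧ α x = i}

/-- The arc relation of the reversed digraph. -/
abbrev rev (A : W → W → Prop) : W → W → Prop := fun u v => A v u

theorem Adj.symm {u v : W} (h : Adj A u v) : Adj A v u := Or.symm h

theorem Adj.of_rev {u v : W} (h : Adj (rev A) u v) : Adj A u v := Or.symm h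

theorem Acyc.reverse {S : Set W} (h : Acyc A S) : Acyc (rev A) S := by
  intro T hT hne
  obtain ⟨v, hv, h⟩ := h T hT hne
  exact ⟨v, hv, h.symm⟩

theorem Col.reverse {X : Set W} {α : W → Fin k} (h : Col A X α) : Col (rev A) X α :=
  fun i => (h i).reverse

theorem Col.mono {X Y : Set W} {α : W → Fin k} (h : Col A X α) (hY : Y ⊆ X) : Col A Y α :=
  fun i T hT hne => h i T (fun _ hx => ⟨hY (hT hx).1, (hT hx).2⟩) hne

theorem col_empty (α : W → Fin k) : Col A ∅ α := by
  rintro i T hT ⟨x, hx⟩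
  exact (hT hx).1.elim

theorem Col.extend {X : Set W} {α : W → Fin k} {u : W} {c : Fin k} (h : Col A X α)
    (hirr : ∀ v, ¬ A v v)
    (hc : (∀ w ∈ X, α w = c → ¬ A w u) ∨ (∀ w ∈ X, α w = c → ¬ A u w)) :
    Col A (insert u X) (Function.update α u c) := by
  intro i T hT hne
  have hX : ∀ w ∈ T, w ≠ u → w ∈ X ∧ α w = i := by
    intro w hw hwu
    have := hT hw
    simp only [Set.mem_ofPred_eq, Set.mem_insert_iff, hwu, false_or,
      Function.update_of_ne hwu] at this
    exact this
  by_cases huT : u ∈ T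
  · have hi : c = i := by
      have := (hT huT).2
      simpa using this
    subst hi
    refine ⟨u, huT, ?_⟩
    rcases hc with hc | hc
    · left
      intro w hw
      by_cases hwu : w = u
      · exact hwu ▸ hirr w
      · exact hc w (hX w hw hwu).1 (hX w hw hwu).2
    · right
      intro w hw
      by_cases hwu : w = u
      · exact hwu ▸ hirr w
      · exact hc w (hX w hw hwu).1 (hX w hw hwu).2
  · exact h i T (fun w hw => hX w hw (fun e => huT (e ▸ hw))) hne

theorem exists_unused_colour {N : Finset W} (hN : N.card < k) (α : W → Fin k) :
    ∃ c, ∀ w ∈ N, α w ≠ c := by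
  by_contra! h
  have : (Finset.univ : Finset (Fin k)) ⊆ N.image α := by
    intro c _
    obtain ⟨w, hw, hc⟩ := h c
    exact Finset.mem_image.2 ⟨w, hw, hc⟩
  have h1 := Finset.card_le_card this
  have h2 := Finset.card_image_le (s := N) (f := α)
  simp at h1
  omega

/-- `c` runs periodically around a cycle of length `L` of the underlying graph. -/
structure Cyc (A : W → W → Prop) (c : ℕ → W) (L : ℕ) : Prop where
  three_le : 3 ≤ L
  adj : ∀ n, Adj A (c n) (c (n + 1))
  period : ∀ n, c (n + L) = c n
  inj : ∀ a b, c a = c b → a ≡ b [MOD L]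

namespace Cyc

variable {c : ℕ → W} {L : ℕ}

theorem shift (hc : Cyc A c L) (j : ℕ) : Cyc A (fun n => c (j + n)) L where
  three_le := hc.three_le
  adj n := hc.adj (j + n)
  period n := by rw [← add_assoc, hc.period]
  inj a b hab := Nat.ModEq.add_left_cancel' j (hc.inj _ _ hab)

theorem reverse (hc : Cyc A c L) : Cyc (rev A) c L where
  three_le := hc.three_le
  adj n := (hc.adj n).symm
  period := hc.period
  inj := hc.inj

theorem eq_of_lt (hc : Cyc A c L) {a b : ℕ} (ha : a < L) (hb : b < L) (h : c a = c b) : a = b :=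
  (hc.inj a b h).eq_of_lt_of_lt ha hb

theorem apply_mod (hc : Cyc A c L) (n : ℕ) : c (n % L) = c n := by
  have : ∀ q, c (n % L + L * q) = c (n % L) := by
    intro q
    induction q with
    | zero => rfl
    | succ q ih => rw [Nat.mul_succ, ← add_assoc, hc.period, ih]
  rw [← this (n / L), Nat.mod_add_div]

theorem exists_lt (hc : Cyc A c L) {u : W} (hu : ∃ i, u = c i) : ∃ i < L, u = c i := by
  obtain ⟨i, rfl⟩ := hu
  exact ⟨i % L, Nat.mod_lt _ (by have := hc.three_le; omega), (hc.apply_mod i).symm⟩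

/-- Closing up a path to a cycle. -/
theorem of_path {p : ℕ → W} {L : ℕ} (hL : 3 ≤ L) (hadj : ∀ n, n + 1 < L → Adj A (p n) (p (n + 1)))
    (hclose : Adj A (p (L - 1)) (p 0)) (hinj : ∀ a < L, ∀ b < L, p a = p b → a = b) :
    Cyc A (fun n => p (n % L)) L where
  three_le := hL
  adj n := by
    have hlt := Nat.mod_lt n (by omega : 0 < L)
    show Adj A (p (n % L)) (p ((n + 1) % L))
    by_cases hn : n % L + 1 < L
    · rw [Nat.add_mod n 1 L, Nat.mod_eq_of_lt (by omega : 1 < L), Nat.mod_eq_of_lt hn]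
      exact hadj _ hn
    · have e : n % L = L - 1 := by omega
      rw [Nat.add_mod n 1 L, Nat.mod_eq_of_lt (by omega : 1 < L), e,
        Nat.sub_add_cancel (by omega), Nat.mod_self]
      exact hclose
  period n := by simp
  inj a b hab := hinj _ (Nat.mod_lt _ (by omega)) _ (Nat.mod_lt _ (by omega)) hab

end Cyc

/-- The neighbours of `v` are `x` and `y`, all joined by digons, while `x` and `y` are not
joined by a digon. -/
structure Thin (A : W → W → Prop) (v x y : W) : Prop where
  ne : x ≠ y
  not_digon : ¬ (A x y ∧ A y x)
  in_iff : ∀ q, A q v ↔ q = x ∨ q = y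
  out_iff : ∀ q, A v q ↔ q = x ∨ q = y

theorem Thin.symm {v x y : W} (t : Thin A v x y) : Thin A v y x :=
  ⟨t.ne.symm, fun h => t.not_digon h.symm, fun q => (t.in_iff q).trans or_comm,
    fun q => (t.out_iff q).trans or_comm⟩

variable [Fintype W]

theorem exists_col_of_inDeg_lt (hirr : ∀ v, ¬ A v v)
    (hin : ∀ v, (Finset.univ.filter fun u => A u v).card < k) :
    ∃ α : W → Fin k, Col A Set.univ α := by
  have key : ∀ S : Finset W, ∃ α : W → Fin k, Col A (S : Set W) α := by
    intro S
    induction S using Finset.induction_on with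
    | empty =>
      rcases isEmpty_or_nonempty W with hW | ⟨⟨v⟩⟩
      · exact ⟨fun v => (hW.false v).elim, by simpa using col_empty _⟩
      · exact ⟨fun _ => ⟨0, by have := hin v; omega⟩, by simpa using col_empty _⟩
    | insert u S hu ih =>
      obtain ⟨α, hα⟩ := ih
      obtain ⟨c, hc⟩ := exists_unused_colour (hin u) α
      refine ⟨Function.update α u c, ?_⟩
      rw [Finset.coe_insert]
      refine hα.extend hirr (Or.inl fun w _ hw ha => hc w (by simpa using ha) hw)
  simpa using key Finset.univ

/-- A connected loopless digraph with in- and out-degrees at most `k` that has no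
`k`-dicolouring. -/
structure Stuck (A : W → W → Prop) (k : ℕ) : Prop where
  irrefl : ∀ v, ¬ A v v
  in_le : ∀ v, (Finset.univ.filter fun u => A u v).card ≤ k
  out_le : ∀ v, (Finset.univ.filter fun u => A v u).card ≤ k
  conn : ∀ S : Set W, S.Nonempty → Sᶜ.Nonempty → ∃ u ∈ S, ∃ w ∈ Sᶜ, Adj A u w
  not_col : ¬ ∃ α : W → Fin k, Col A Set.univ α
  pos : 0 < k

namespace Stuck

theorem reverse (h : Stuck A k) : Stuck (rev A) k where
  irrefl := h.irrefl
  in_le := h.out_le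
  out_le := h.in_le
  conn S h1 h2 := by
    obtain ⟨u, hu, w, hw, ha⟩ := h.conn S h1 h2
    exact ⟨u, hu, w, hw, Or.symm ha⟩
  not_col := fun ⟨α, hα⟩ => h.not_col ⟨α, hα.reverse⟩
  pos := h.pos

theorem adj_ne (h : Stuck A k) {u v : W} (ha : Adj A u v) : u ≠ v := by
  rintro rfl
  exact h.irrefl u (ha.elim id id)

theorem exists_in_colour (h : Stuck A k) {v : W} {α : W → Fin k} (hα : Col A {v}ᶜ α) (c : Fin k) :
    ∃ w, A w v ∧ α w = c := by
  by_contra! hc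
  apply h.not_col
  refine ⟨Function.update α v c, ?_⟩
  have := hα.extend (u := v) (c := c) h.irrefl (Or.inl fun w _ hw ha => hc w ha hw)
  convert this using 1
  ext x
  by_cases hx : x = v <;> simp [hx]

theorem in_injective (h : Stuck A k) {v : W} {α : W → Fin k} (hα : Col A {v}ᶜ α) {x y : W}
    (hx : A x v) (hy : A y v) (hxy : α x = α y) : x = y := by
  have hs : Set.SurjOn α (Finset.univ.filter fun u => A u v : Finset W)
      (Finset.univ : Finset (Fin k)) := by
    intro c _
    obtain ⟨w, hw, hc⟩ := h.exists_in_colour hα c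
    exact ⟨w, by simpa using hw, hc⟩
  exact Finset.injOn_of_surjOn_of_card_le α (fun _ _ => by simp) hs (by simpa using h.in_le v)
    (by simpa using hx) (by simpa using hy) hxy

theorem out_injective (h : Stuck A k) {v : W} {α : W → Fin k} (hα : Col A {v}ᶜ α) {x y : W}
    (hx : A v x) (hy : A v y) (hxy : α x = α y) : x = y :=
  h.reverse.in_injective hα.reverse hx hy hxy

/-- The uncoloured vertex can be moved from `v` to any neighbour `u`, recolouring `v` with the
colour of `u`. -/
theorem move (h : Stuck A k) {v u : W} {α : W → Fin k} (hα : Col A {v}ᶜ α) (ha : Adj A v u) :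
    Col A {u}ᶜ (Function.update α v (α u)) := by
  have hne := h.adj_ne ha
  have := (hα.mono (Y := {u, v}ᶜ) (by intro x; simp)).extend (u := v) (c := α u) h.irrefl
    (by
      rcases ha with ha | ha
      · right
        intro w hw hc hA
        exact hw (Or.inl (h.out_injective hα hA ha hc))
      · left
        intro w hw hc hA
        exact hw (Or.inl (h.in_injective hα hA ha hc)))
  convert this using 1
  ext x
  by_cases hx : x = v
  · simp [hx, hne]
  · simp [hx]

theorem exists_extend (h : Stuck A k) {X : Set W} {α : W → Fin k} {u w : W} (hα : Col A X α)
    (hw : w ∉ X) (ha : Adj A u w) :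
    ∃ c, Col A (insert u X) (Function.update α u c) := by
  wlog hA : A w u generalizing A
  · obtain ⟨c, hc⟩ := this h.reverse hα.reverse ha.symm (ha.resolve_right hA)
    exact ⟨c, hc.reverse⟩
  have hcard : ((Finset.univ.filter fun x => A x u).erase w).card < k := by
    rw [Finset.card_erase_of_mem (by simpa using hA)]
    have := h.in_le u
    have := h.pos
    omega
  obtain ⟨c, hc⟩ := exists_unused_colour hcard α
  refine ⟨c, hα.extend h.irrefl (Or.inl fun x hx hxc hxu => hc x ?_ hxc)⟩
  simp only [Finset.mem_erase, Finset.mem_filter, Finset.mem_univ, true_and]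
  exact ⟨fun e => hw (e ▸ hx), hxu⟩

/-- Greedy colouring towards a root `r`. -/
theorem greedy (h : Stuck A k) {X : Set W} {α : W → Fin k} (hα : Col A X α) {r : W}
    (hcut : ∀ S : Set W, S.Nonempty → (∀ x ∈ S, x ∉ X) → r ∉ S →
      ∃ u ∈ S, ∃ w, w ∉ S ∧ w ∉ X ∧ Adj A u w) :
    ∃ β : W → Fin k, Col A {r}ᶜ β ∧ ∀ x ∈ X, β x = α x := by
  have key : ∀ n, ∀ S : Finset W, S.card = n → (∀ x ∈ S, x ∉ X) → r ∉ S →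
      ∃ β : W → Fin k, Col A (X ∪ S) β ∧ ∀ x ∈ X, β x = α x := by
    intro n
    induction n with
    | zero =>
      intro S hS _ _
      obtain rfl := Finset.card_eq_zero.1 hS
      exact ⟨α, by simpa using hα, fun _ _ => rfl⟩
    | succ n ih =>
      intro S hS hSX hrS
      obtain ⟨u, hu, w, hwS, hwX, ha⟩ := hcut S
        (by simpa using Finset.card_pos.1 (by omega : 0 < S.card)) hSX (by simpa using hrS)
      have hu : u ∈ S := by simpa using hu
      have hwS : w ∉ S := by simpa using hwS
      obtain ⟨β, hβ, hβα⟩ := ih (S.erase u) (by rw [Finset.card_erase_of_mem hu]; omega)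
        (fun x hx => hSX x (Finset.mem_of_mem_erase hx)) (fun hx => hrS (Finset.mem_of_mem_erase hx))
      obtain ⟨c, hc⟩ := h.exists_extend hβ (u := u) (w := w) (by simp [hwX, hwS]) ha
      refine ⟨Function.update β u c, ?_, fun x hx => ?_⟩
      · convert hc using 1
        rw [← Set.union_insert, ← Finset.coe_insert, Finset.insert_erase hu]
      · rw [Function.update_of_ne (by rintro rfl; exact hSX _ hu hx)]
        exact hβα x hx
  obtain ⟨β, hβ, hβα⟩ := key _ (Finset.univ.filter fun x => x ∉ X ∧ x ≠ r) rfl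
    (fun x hx => by simp at hx; exact hx.1) (by simp)
  refine ⟨β, hβ.mono fun x hx => ?_, hβα⟩
  by_cases hxX : x ∈ X
  · exact Or.inl hxX
  · right
    simpa [hxX] using hx

theorem exists_state (h : Stuck A k) (v : W) : ∃ α : W → Fin k, Col A {v}ᶜ α := by
  obtain ⟨β, hβ, -⟩ := h.greedy (X := ∅) (α := fun _ => ⟨0, h.pos⟩) (col_empty _) (r := v)
    (fun S hS _ hv => by
      obtain ⟨u, hu, w, hw, ha⟩ := h.conn S hS ⟨v, hv⟩
      exact ⟨u, hu, w, hw, by simp, ha⟩)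
  exact ⟨β, hβ⟩

variable {c : ℕ → W} {L : ℕ}

/-- Moving the uncoloured vertex along a cycle shifts the colours. -/
theorem slide (h : Stuck A k) (hc : Cyc A c L) {α : W → Fin k} (hα : Col A {c 0}ᶜ α) (j : ℕ)
    (hj : j < L) :
    ∃ β : W → Fin k, Col A {c j}ᶜ β ∧ (∀ i < j, β (c i) = α (c (i + 1))) ∧
      ∀ x, (∀ i < j, x ≠ c i) → β x = α x := by
  induction j with
  | zero => exact ⟨α, hα, by simp, by simp⟩
  | succ j ih =>
    obtain ⟨β, hβ, h1, h2⟩ := ih (by omega)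
    refine ⟨_, h.move hβ (hc.adj j), fun i hi => ?_, fun x hx => ?_⟩
    · by_cases hij : i = j
      · subst hij
        rw [Function.update_self]
        exact h2 _ fun i' hi' e => by have := hc.eq_of_lt hj (by omega) e; omega
      · rw [Function.update_of_ne fun e => hij (hc.eq_of_lt (by omega) (by omega) e)]
        exact h1 i (by omega)
    · rw [Function.update_of_ne (hx j (by omega))]
      exact h2 x fun i hi => hx i (by omega)

/-- Moving the uncoloured vertex once around a cycle rotates the colours. -/
theorem rotate (h : Stuck A k) (hc : Cyc A c L) {α : W → Fin k} (hα : Col A {c 0}ᶜ α) :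
    ∃ β : W → Fin k, Col A {c 0}ᶜ β ∧ (∀ i, 1 ≤ i → i + 1 < L → β (c i) = α (c (i + 1))) ∧
      β (c (L - 1)) = α (c 1) ∧ ∀ x, (∀ i < L, x ≠ c i) → β x = α x := by
  have hL := hc.three_le
  obtain ⟨β, hβ, h1, h2⟩ := h.slide hc hα (L - 1) (by omega)
  have hadj : Adj A (c (L - 1)) (c 0) := by
    have := hc.adj (L - 1)
    rwa [Nat.sub_add_cancel (by omega), ← Nat.zero_add L, hc.period, Nat.zero_add] at this
  refine ⟨_, h.move hβ hadj, fun i hi hiL => ?_, ?_, fun x hx => ?_⟩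
  · rw [Function.update_of_ne fun e => by have := hc.eq_of_lt (by omega) (by omega) e; omega]
    exact h1 i (by omega)
  · rw [Function.update_self]
    exact h1 0 (by omega)
  · rw [Function.update_of_ne (hx _ (by omega))]
    exact h2 x fun i hi => hx i (by omega)

/-- All colours seen on a cycle stay there when the uncoloured vertex moves along the cycle. -/
theorem exists_state_on_cycle (h : Stuck A k) (hc : Cyc A c L) {α : W → Fin k}
    (hα : Col A {c 0}ᶜ α) (j : ℕ) :
    ∃ β : W → Fin k, Col A {c j}ᶜ β ∧
      ∀ i, 1 ≤ i → i < L → ∃ i', 1 ≤ i' ∧ i' < L ∧ β (c (j + i')) = α (c i) := by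
  have hL := hc.three_le
  induction j with
  | zero => exact ⟨α, hα, fun i h1 h2 => ⟨i, h1, h2, by simp⟩⟩
  | succ j ih =>
    obtain ⟨β, hβ, hK⟩ := ih
    have hs := hc.shift j
    refine ⟨_, h.move hβ (hc.adj j), fun i h1 h2 => ?_⟩
    obtain ⟨i', h1', h2', e⟩ := hK i h1 h2
    by_cases hi : i' = 1
    · subst hi
      refine ⟨L - 1, by omega, by omega, ?_⟩
      rw [show j + 1 + (L - 1) = j + L by omega, hc.period, Function.update_self, e]
    · refine ⟨i' - 1, by omega, by omega, ?_⟩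
      rw [show j + 1 + (i' - 1) = j + i' by omega, Function.update_of_ne, e]
      intro he
      have := hs.eq_of_lt (a := i') (b := 0) h2' (by omega) (by simpa using he)
      omega

/-- If the uncoloured vertex `c 0` has an in-neighbour on the cycle, then its in-neighbours off
the cycle have colours not seen on the cycle. -/
theorem off_cycle_colour (h : Stuck A k) (hc : Cyc A c L) {s : ℕ} (hs : 1 ≤ s) (hsL : s < L)
    (hA : A (c s) (c 0)) {u : W} (hu : ∀ i < L, u ≠ c i) (hAu : A u (c 0)) {j : ℕ} (hj : 1 ≤ j)
    (hjL : j < L) {α : W → Fin k} (hα : Col A {c 0}ᶜ α) : α u ≠ α (c j) := by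
  have up : ∀ i, 1 ≤ i → (∀ α : W → Fin k, Col A {c 0}ᶜ α → α u ≠ α (c i)) →
      ∀ j, i ≤ j → j < L → ∀ α : W → Fin k, Col A {c 0}ᶜ α → α u ≠ α (c j) := by
    intro i hi h0 j hij
    induction j, hij using Nat.le_induction with
    | base => intro _; exact h0
    | succ j hij ih =>
      intro hjL α hα
      obtain ⟨β, hβ, h1, -, h3⟩ := h.rotate hc hα
      rw [← h3 u hu, ← h1 j (by omega) hjL]
      exact ih (by omega) β hβ
  have hlast := up s hs (fun α hα e => hu s hsL (h.in_injective hα hAu hA e)) (L - 1) (by omega)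
    (by omega)
  refine up 1 le_rfl (fun α hα => ?_) j hj hjL α hα
  obtain ⟨β, hβ, -, h2, h3⟩ := h.rotate hc hα
  rw [← h3 u hu, ← h2]
  exact hlast β hβ

theorem exists_in_colour_on_cycle (h : Stuck A k) {α β : W → Fin k}
    (hα : Col A {c 0}ᶜ α) (hβ : Col A {c 0}ᶜ β)
    (hout : ∀ x, (∀ i < L, x ≠ c i) → β x = α x) {s : ℕ} (hs : s < L) (hA : A (c s) (c 0)) :
    ∃ i, 1 ≤ i ∧ i < L ∧ A (c i) (c 0) ∧ β (c i) = α (c s) := by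
  obtain ⟨x, hx, hxc⟩ := h.exists_in_colour hβ (α (c s))
  by_cases hxC : ∀ i < L, x ≠ c i
  · rw [hout x hxC] at hxc
    exact (hxC s hs (h.in_injective hα hx hA hxc)).elim
  · push Not at hxC
    obtain ⟨i, hi, rfl⟩ := hxC
    refine ⟨i, ?_, hi, hx, hxc⟩
    rcases Nat.eq_zero_or_pos i with rfl | hi
    · exact (h.irrefl _ hx).elim
    · exact hi

/-- If exactly one of the two neighbours of `c 0` on a cycle is an in-neighbour of `c 0`, and
`c 0` lies on no chord, then the cycle is monochromatic. -/
theorem colour_eq_of_one_in (h : Stuck A k) (hc : Cyc A c L)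
    (hch : ∀ i, 1 ≤ i → i < L → Adj A (c i) (c 0) → i = 1 ∨ i = L - 1)
    (hne : ¬ (A (c 1) (c 0) ↔ A (c (L - 1)) (c 0))) {α : W → Fin k} (hα : Col A {c 0}ᶜ α)
    {i : ℕ} (hi : 1 ≤ i) (hiL : i < L) : α (c i) = α (c 1) := by
  have hL := hc.three_le
  have base : ∀ α : W → Fin k, Col A {c 0}ᶜ α → α (c 2) = α (c 1) := by
    by_cases hA : A (c 1) (c 0)
    · have hA' : ¬ A (c (L - 1)) (c 0) := fun h' => hne ⟨fun _ => h', fun _ => hA⟩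
      intro α hα
      obtain ⟨β, hβ, h1, h2, h3⟩ := h.rotate hc hα
      obtain ⟨i, hi, hiL, hAi, e⟩ := h.exists_in_colour_on_cycle hα hβ h3 (by omega) hA
      rcases hch i hi hiL (Or.inl hAi) with rfl | rfl
      · rw [← e, h1 1 le_rfl (by omega)]
      · exact (hA' hAi).elim
    · have hA' : A (c (L - 1)) (c 0) := by
        by_contra h'
        exact hne ⟨fun h => (hA h).elim, fun h => (h' h).elim⟩
      have hlast : ∀ α : W → Fin k, Col A {c 0}ᶜ α → α (c 1) = α (c (L - 1)) := by
        intro α hα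
        obtain ⟨β, hβ, h1, h2, h3⟩ := h.rotate hc hα
        obtain ⟨i, hi, hiL, hAi, e⟩ := h.exists_in_colour_on_cycle hα hβ h3 (by omega) hA'
        rcases hch i hi hiL (Or.inl hAi) with rfl | rfl
        · exact (hA hAi).elim
        · rw [← e, h2]
      intro α hα
      obtain ⟨β, hβ, h1, h2, h3⟩ := h.rotate hc hα
      rw [← h2, ← hlast β hβ, h1 1 le_rfl (by omega)]
  have step : ∀ i, 1 ≤ i → i + 1 < L → ∀ α : W → Fin k, Col A {c 0}ᶜ α →
      α (c (i + 1)) = α (c i) := by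
    intro i hi
    induction i, hi using Nat.le_induction with
    | base => intro _; exact base
    | succ i hi ih =>
      intro hiL α hα
      obtain ⟨β, hβ, h1, -, -⟩ := h.rotate hc hα
      rw [← h1 (i + 1) (by omega) (by omega), ← h1 i hi (by omega)]
      exact ih (by omega) β hβ
  induction i, hi using Nat.le_induction with
  | base => rfl
  | succ i hi ih => rw [step i hi hiL α hα, ih (by omega)]

/-- If both neighbours of `c 0` on a cycle are in-neighbours of `c 0`, and `c 0` lies on no chord,
then the cycle is odd. -/
theorem odd_of_two_in (h : Stuck A k) (hc : Cyc A c L)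
    (hch : ∀ i, 1 ≤ i → i < L → Adj A (c i) (c 0) → i = 1 ∨ i = L - 1)
    (hA : A (c 1) (c 0)) (hA' : A (c (L - 1)) (c 0)) : Odd L := by
  have hL := hc.three_le
  have hdiff : ∀ α : W → Fin k, Col A {c 0}ᶜ α → α (c 1) ≠ α (c (L - 1)) := by
    intro α hα e
    have := hc.eq_of_lt (by omega) (by omega) (h.in_injective hα hA hA' e)
    omega
  have base : ∀ α : W → Fin k, Col A {c 0}ᶜ α → α (c 2) = α (c (L - 1)) := by
    intro α hα
    obtain ⟨β, hβ, h1, h2, h3⟩ := h.rotate hc hα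
    obtain ⟨i, hi, hiL, hAi, e⟩ := h.exists_in_colour_on_cycle hα hβ h3 (by omega) hA'
    rcases hch i hi hiL (Or.inl hAi) with rfl | rfl
    · rw [← e, h1 1 le_rfl (by omega)]
    · exact (hdiff α hα (by rw [← e, h2])).elim
  have step : ∀ i, 1 ≤ i → i + 2 < L → ∀ α : W → Fin k, Col A {c 0}ᶜ α →
      α (c (i + 2)) = α (c i) := by
    intro i hi
    induction i, hi using Nat.le_induction with
    | base =>
      intro hiL α hα
      obtain ⟨β, hβ, h1, h2, h3⟩ := h.rotate hc hα
      rw [← h2, ← base β hβ, h1 2 (by omega) hiL]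
    | succ i hi ih =>
      intro hiL α hα
      obtain ⟨β, hβ, h1, -, -⟩ := h.rotate hc hα
      rw [← h1 i hi (by omega), ← ih (by omega) β hβ, h1 (i + 2) (by omega) (by omega)]
  obtain ⟨α, hα⟩ := h.exists_state (c 0)
  have hodd : ∀ n, 2 * n + 1 < L → α (c (2 * n + 1)) = α (c 1) := by
    intro n
    induction n with
    | zero => simp
    | succ n ih =>
      intro hn
      rw [← ih (by omega)]
      exact step (2 * n + 1) (by omega) (by omega) α hα
  by_contra hodd'
  obtain ⟨n, hn⟩ := Nat.not_odd_iff_even.1 hodd'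
  apply hdiff α hα
  rw [show L - 1 = 2 * (n - 1) + 1 by omega]
  exact (hodd (n - 1) (by omega)).symm

/-- A chordless cycle has no source. -/
theorem exists_in_of_chordless (h : Stuck A k) (hc : Cyc A c L)
    (hch : ∀ a b, a < b → b < L → Adj A (c a) (c b) → b = a + 1 ∨ (a = 0 ∧ b = L - 1)) :
    ∃ i, 1 ≤ i ∧ i < L ∧ A (c i) (c 0) := by
  have hL := hc.three_le
  by_contra! hsrc
  have hlast : c L = c 0 := by simpa using hc.period 0
  have hloc : ∀ j < L, ∀ i, 1 ≤ i → i < L → Adj A (c (j + i)) (c (j + 0)) →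
      i = 1 ∨ i = L - 1 := by
    intro j hj i hi hiL ha
    by_cases hji : j + i < L
    · have := hch j (j + i) (by omega) hji ha.symm
      omega
    · have e : c (j + i) = c (j + i - L) := by
        rw [← hc.period (j + i - L), Nat.sub_add_cancel (by omega)]
      rw [e] at ha
      have := hch (j + i - L) j (by omega) hj ha
      omega
  have hA1 : A (c 0) (c 1) := (hc.adj 0).resolve_right (hsrc 1 le_rfl (by omega))
  have hA2 : A (c 0) (c (L - 1)) := by
    have := hc.adj (L - 1)
    rw [Nat.sub_add_cancel (by omega), hlast] at this
    exact this.resolve_left (hsrc _ (by omega) (by omega))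
  have hodd : Odd L := h.reverse.odd_of_two_in hc.reverse
    (fun i h1 h2 ha => hloc 0 (by omega) i h1 h2
      (by simpa only [zero_add] using ha.of_rev)) hA1 hA2
  obtain ⟨α, hα⟩ := h.exists_state (c 0)
  have hdiff : α (c 1) ≠ α (c (L - 1)) := fun e => by
    have := hc.eq_of_lt (by omega) (by omega) (h.out_injective hα hA1 hA2 e)
    omega
  have hboth : ∀ j, j + 1 < L → (A (c (j + 2)) (c (j + 1)) ↔ A (c j) (c (j + 1))) ∧
      (A (c (j + 1)) (c (j + 2)) ↔ A (c (j + 1)) (c j)) := by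
    intro j hj
    obtain ⟨β, hβ, hK⟩ := h.exists_state_on_cycle hc hα (j + 1)
    obtain ⟨i₁, h1, h1', e₁⟩ := hK 1 le_rfl (by omega)
    obtain ⟨i₂, h2, h2', e₂⟩ := hK (L - 1) (by omega) (by omega)
    have hback : c (j + 1 + (L - 1)) = c j := by
      rw [show j + 1 + (L - 1) = j + L by omega, hc.period]
    have hs := hc.shift (j + 1)
    constructor
    · by_contra hne
      have hcol := fun {i} => h.colour_eq_of_one_in hs (hloc (j + 1) hj)
        (by simpa only [hback, add_zero] using hne) (α := β) hβ (i := i)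
      exact hdiff (by rw [← e₁, ← e₂, hcol h1 h1', hcol h2 h2'])
    · by_contra hne
      have hcol := fun {i} => h.reverse.colour_eq_of_one_in hs.reverse
        (fun i h1 h2 ha => hloc (j + 1) hj i h1 h2 ha.of_rev)
        (by simpa only [hback, add_zero] using hne) (α := β) hβ.reverse (i := i)
      exact hdiff (by rw [← e₁, ← e₂, hcol h1 h1', hcol h2 h2'])
  have halt : ∀ n, 2 * n < L → A (c (2 * n)) (c (2 * n + 1)) ∧ ¬ A (c (2 * n + 1)) (c (2 * n)) := by
    intro n
    induction n with
    | zero => exact fun _ => ⟨hA1, hsrc 1 le_rfl (by omega)⟩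
    | succ n ih =>
      intro hn
      obtain ⟨i1, i2⟩ := ih (by omega)
      obtain ⟨b1, b2⟩ := hboth (2 * n) (by omega)
      obtain ⟨b3, b4⟩ := hboth (2 * n + 1) (by omega)
      exact ⟨b4.2 (b1.2 i1), fun h' => i2 (b2.1 (b3.1 h'))⟩
  obtain ⟨n, hn⟩ := hodd
  have hfin := (halt n (by omega)).1
  rw [← hn, hlast] at hfin
  exact hsrc (2 * n) (by omega) (by omega) hfin

/-- Every vertex on a cycle has an in-neighbour on the cycle. -/
theorem exists_in_on_cycle (h : Stuck A k) (hc : Cyc A c L) :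
    ∃ i, 1 ≤ i ∧ i < L ∧ A (c i) (c 0) := by
  induction L using Nat.strong_induction_on generalizing c with
  | _ L ih =>
  have hL := hc.three_le
  by_cases hch : ∀ a b, a < b → b < L → Adj A (c a) (c b) → b = a + 1 ∨ (a = 0 ∧ b = L - 1)
  · exact h.exists_in_of_chordless hc hch
  push Not at hch
  obtain ⟨a, b, hab, hbL, hadj, h1, h2⟩ := hch
  have hlast : c L = c 0 := by simpa using hc.period 0
  have h3 : a = 0 → b < L - 1 := fun ha => by have := h2 ha; omega
  let f : ℕ → ℕ := fun n => if n ≤ a then n else n + (b - a - 1)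
  have hf : ∀ n, f n = if n ≤ a then n else n + (b - a - 1) := fun _ => rfl
  have hlt : ∀ n, n < L - (b - a - 1) → f n < L := by
    intro n hn
    rw [hf]
    split_ifs <;> omega
  have hcyc : Cyc A (fun n => c (f (n % (L - (b - a - 1))))) (L - (b - a - 1)) := by
    apply Cyc.of_path (p := fun n => c (f n)) (by omega)
    · intro n hn
      show Adj A (c (f n)) (c (f (n + 1)))
      rcases lt_trichotomy n a with hna | hna | hna
      · rw [hf, hf, if_pos (by omega), if_pos (by omega)]
        exact hc.adj n
      · rw [hf, hf, if_pos (by omega), if_neg (by omega), hna,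
          show a + 1 + (b - a - 1) = b by omega]
        exact hadj
      · rw [hf, hf, if_neg (by omega), if_neg (by omega),
          show n + 1 + (b - a - 1) = n + (b - a - 1) + 1 by omega]
        exact hc.adj _
    · show Adj A (c (f (L - (b - a - 1) - 1))) (c (f 0))
      rw [hf, hf, if_neg (by omega), if_pos (by omega),
        show L - (b - a - 1) - 1 + (b - a - 1) = L - 1 by omega]
      have := hc.adj (L - 1)
      rwa [Nat.sub_add_cancel (by omega), hlast] at this
    · intro m hm n hn e
      have := hc.eq_of_lt (hlt m hm) (hlt n hn) e
      rw [hf, hf] at this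
      split_ifs at this <;> omega
  obtain ⟨i, hi, hiL, hA⟩ := ih _ (by omega) hcyc
  simp only [Nat.mod_eq_of_lt hiL, Nat.zero_mod] at hA
  have hf0 : f 0 = 0 := by simp [hf]
  rw [hf0] at hA
  refine ⟨f i, ?_, hlt i hiL, hA⟩
  rw [hf]
  split_ifs <;> omega

/-- A cycle with a vertex all of whose neighbours lie on the cycle is spanning. -/
theorem cycle_spanning (h : Stuck A k) (hc : Cyc A c L)
    (hw : ∀ u, Adj A u (c 0) → ∃ i, u = c i) (x : W) : ∃ i, x = c i := by
  have off : ∀ {A : W → W → Prop} (_ : Stuck A k) (_ : Cyc A c L)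
      (_ : ∀ u, Adj A u (c 0) → ∃ i, u = c i) (j : ℕ) (u : W), A u (c j) → ∃ i, u = c i := by
    intro A h hc hw j u hu
    by_contra! hout
    obtain ⟨α, hα⟩ := h.exists_state (c 0)
    obtain ⟨β, hβ, hK⟩ := h.exists_state_on_cycle hc hα j
    obtain ⟨y, hy, hyc⟩ := h.exists_in_colour hα (β u)
    obtain ⟨i, hiL, rfl⟩ := hc.exists_lt (hw y (Or.inl hy))
    have hi : 1 ≤ i := Nat.one_le_iff_ne_zero.2 fun e => h.irrefl _ (e ▸ hy)
    obtain ⟨i', h1, h2, e⟩ := hK i hi hiL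
    have hs := hc.shift j
    obtain ⟨s, hs1, hsL, hA⟩ := h.exists_in_on_cycle hs
    exact h.off_cycle_colour hs hs1 hsL hA (fun i _ => hout (j + i)) hu h1 h2 hβ
      (by rw [e, hyc])
  by_contra hx
  obtain ⟨u, ⟨j, rfl⟩, v, hv, ha⟩ := h.conn {y | ∃ i, y = c i} ⟨c 0, 0, rfl⟩ ⟨x, hx⟩
  rcases ha with ha | ha
  · exact hv (off h.reverse hc.reverse (fun u hu => hw u hu.of_rev) j v ha)
  · exact hv (off h hc hw j v ha)

theorem exists_in_ne (h : Stuck A k) (hk : 2 ≤ k) (v z : W) : ∃ w, A w v ∧ w ≠ z := by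
  obtain ⟨α, hα⟩ := h.exists_state v
  obtain ⟨w₀, h₀, e₀⟩ := h.exists_in_colour hα ⟨0, by omega⟩
  obtain ⟨w₁, h₁, e₁⟩ := h.exists_in_colour hα ⟨1, by omega⟩
  by_cases hz : w₀ = z
  · refine ⟨w₁, h₁, fun e => ?_⟩
    rw [e, ← hz, e₀] at e₁
    simp at e₁
  · exact ⟨w₀, h₀, hz⟩

/-- A path on three vertices extends to a spanning path, and there is a spanning cycle. -/
theorem exists_spanning_path (h : Stuck A k) (hk : 2 ≤ k) {x v y : W} (hxv : Adj A x v)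
    (hvy : Adj A v y) (hxy : x ≠ y) :
    ∃ (p : ℕ → W) (r : ℕ), p 0 = x ∧ p 1 = v ∧ p 2 = y ∧ 2 ≤ r ∧
      (∀ a ≤ r, ∀ b ≤ r, p a = p b → a = b) ∧ (∀ n < r, Adj A (p n) (p (n + 1))) ∧
      (∀ u, ∃ i ≤ r, u = p i) ∧ ∃ (c : ℕ → W) (L : ℕ), Cyc A c L ∧ ∀ u, ∃ i, u = c i := by
  let P : ℕ → Prop := fun r => ∃ p : ℕ → W, p 0 = x ∧ p 1 = v ∧ p 2 = y ∧ 2 ≤ r ∧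
      (∀ a ≤ r, ∀ b ≤ r, p a = p b → a = b) ∧ (∀ n < r, Adj A (p n) (p (n + 1)))
  have hbound : ∀ r, P r → r ≤ Fintype.card W := by
    rintro r ⟨p, -, -, -, -, hinj, -⟩
    have := Finset.card_le_univ ((Finset.range (r + 1)).image p)
    rw [Finset.card_image_of_injOn, Finset.card_range] at this
    · omega
    · intro a ha b hb e
      simp only [Finset.coe_range, Set.mem_Iio] at ha hb
      exact hinj a (by omega) b (by omega) e
  have hP2 : P 2 := by
    have h1 := h.adj_ne hxv
    have h2 := h.adj_ne hvy
    refine ⟨fun n => if n = 0 then x else if n = 1 then v else y, by simp, by simp, by simp, le_rfl,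
      ?_, ?_⟩
    · intro a ha b hb e
      interval_cases a <;> interval_cases b <;> simp_all
    · intro n hn
      interval_cases n <;> simpa
  obtain ⟨r, hr, hmax⟩ : ∃ r, P r ∧ ∀ r', P r' → r' ≤ r :=
    ⟨_, Nat.findGreatest_spec (hbound 2 hP2) hP2,
      fun r' h' => Nat.le_findGreatest (hbound r' h') h'⟩
  obtain ⟨p, p0, p1, p2, hr2, hinj, hadj⟩ := hr
  have hend : ∀ u, Adj A (p r) u → ∃ i < r, u = p i := by
    intro u hu
    by_contra! hout
    have hout' : ∀ i ≤ r, u ≠ p i := fun i hi => by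
      rcases Nat.lt_or_eq_of_le hi with hi | rfl
      · exact hout i hi
      · exact (h.adj_ne hu).symm
    have : P (r + 1) := by
      refine ⟨fun n => if n ≤ r then p n else u, by simpa, ?_, ?_, by omega, ?_, ?_⟩
      · simp only [if_pos (by omega : 1 ≤ r), p1]
      · simp only [if_pos hr2, p2]
      · intro a ha b hb e
        simp only at e
        split_ifs at e with h1 h2 h2
        · exact hinj a h1 b h2 e
        · exact (hout' a h1 e.symm).elim
        · exact (hout' b h2 e).elim
        · omega
      · intro n hn
        simp only [if_pos (by omega : n ≤ r)]
        split_ifs with h1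
        · exact hadj n (by omega)
        · rwa [show n = r by omega]
    have := hmax _ this
    omega
  have hback : ∃ i, i + 2 ≤ r ∧ Adj A (p r) (p i) := by
    obtain ⟨w, hw, hne⟩ := h.exists_in_ne hk (p r) (p (r - 1))
    obtain ⟨i, hi, rfl⟩ := hend w (Or.inr hw)
    refine ⟨i, ?_, Or.inr hw⟩
    by_contra hi'
    exact hne (by rw [show i = r - 1 by omega])
  let j := Nat.find hback
  obtain ⟨hj, hjadj⟩ : j + 2 ≤ r ∧ Adj A (p r) (p j) := Nat.find_spec hback
  have hjmin : ∀ i < r, Adj A (p r) (p i) → j ≤ i := by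
    intro i hi ha
    by_cases hi' : i + 2 ≤ r
    · exact Nat.find_min' hback ⟨hi', ha⟩
    · omega
  let f : ℕ → ℕ := fun n => if n = 0 then r else j + n - 1
  have hf0 : f 0 = r := rfl
  have hf : ∀ n, n ≠ 0 → f n = j + n - 1 := fun n hn => if_neg hn
  have hfle : ∀ n < r - j + 1, f n ≤ r := by
    intro n hn
    by_cases h0 : n = 0
    · rw [h0, hf0]
    · rw [hf n h0]
      omega
  have hcyc : Cyc A (fun n => p (f (n % (r - j + 1)))) (r - j + 1) := by
    apply Cyc.of_path (p := fun n => p (f n)) (by omega)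
    · intro n hn
      show Adj A (p (f n)) (p (f (n + 1)))
      by_cases h0 : n = 0
      · rw [h0, hf0, hf _ (by omega)]
        exact hjadj
      · rw [hf n h0, hf _ (by omega), show j + (n + 1) - 1 = j + n - 1 + 1 by omega]
        exact hadj _ (by omega)
    · show Adj A (p (f (r - j + 1 - 1))) (p (f 0))
      rw [hf0, hf _ (by omega)]
      have := hadj (r - 1) (by omega)
      rwa [Nat.sub_add_cancel (by omega), show r - 1 = j + (r - j + 1 - 1) - 1 by omega] at this
    · intro a ha b hb e
      have := hinj _ (hfle a ha) _ (hfle b hb) e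
      by_cases ha0 : a = 0 <;> by_cases hb0 : b = 0
      · omega
      · rw [ha0, hf0, hf b hb0] at this
        omega
      · rw [hb0, hf0, hf a ha0] at this
        omega
      · rw [hf a ha0, hf b hb0] at this
        omega
  have hspan := h.cycle_spanning hcyc (by
    intro u hu
    simp only [Nat.zero_mod, hf0] at hu
    obtain ⟨i, hi, rfl⟩ := hend u hu.symm
    have := hjmin i hi hu.symm
    refine ⟨i - j + 1, ?_⟩
    rw [Nat.mod_eq_of_lt (by omega), hf _ (by omega), show j + (i - j + 1) - 1 = i by omega])
  refine ⟨p, r, p0, p1, p2, hr2, hinj, hadj, fun u => ?_, _, _, hcyc, hspan⟩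
  obtain ⟨i, hi⟩ := hspan u
  exact ⟨_, hfle _ (Nat.mod_lt _ (by omega)), hi⟩

theorem eq_or_eq_of_not_arc (h : Stuck A k) (hk : 2 ≤ k) {v x y q : W} (hxy : x ≠ y)
    (hx : A x v) (hy : A y v) (hnot : ¬ A x y) (hq : Adj A q v) : q = x ∨ q = y := by
  by_contra! hqxy
  obtain ⟨p, r, p0, p1, p2, hr2, hinj, hadj, hspan, -⟩ :=
    h.exists_spanning_path hk (Or.inl hx) (Or.inr hy) hxy
  obtain ⟨s, hs, rfl⟩ := hspan q
  have hs3 : 3 ≤ s := by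
    have h0 : s ≠ 0 := fun e => hqxy.1 (by rw [e, p0])
    have h1 : s ≠ 1 := fun e => h.adj_ne hq (by rw [e, p1])
    have h2 : s ≠ 2 := fun e => hqxy.2 (by rw [e, p2])
    omega
  let α : W → Fin k := fun _ => ⟨0, h.pos⟩
  have hcol : Col A {y, x} α := by
    have h1 := (col_empty (A := A) α).extend (u := x) (c := ⟨0, h.pos⟩) h.irrefl (by simp)
    have h2 := h1.extend (u := y) (c := ⟨0, h.pos⟩) h.irrefl (by
      left
      rintro w (rfl | hw) -
      · exact hnot
      · exact hw.elim)
    have e : Function.update (Function.update α x ⟨0, h.pos⟩) y ⟨0, h.pos⟩ = α := by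
      rw [Function.update_eq_self x α, Function.update_eq_self y α]
    rw [e] at h2
    simpa using h2
  have hbig : ∀ i, 3 ≤ i → i ≤ r → p i ∉ ({y, x} : Set W) := by
    rintro i hi hir (e | e)
    · have := hinj i hir 2 hr2 (by rw [e, p2])
      omega
    · have := hinj i hir 0 (by omega) (by rw [e, p0])
      omega
  obtain ⟨β, hβ, hβα⟩ := h.greedy hcol (r := v) (by
    intro S ⟨z, hz⟩ hSX hvS
    by_contra! hno
    have hup : ∀ i, p i ∈ S → ∀ m, i ≤ m → 3 ≤ i → m ≤ r → p m ∈ S := by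
      intro i hiS m him
      induction m, him using Nat.le_induction with
      | base => intro _ _; exact hiS
      | succ m him ih =>
        intro hi hm
        by_contra hn
        exact hno _ (ih hi (by omega)) _ hn (hbig _ (by omega) hm) (hadj m (by omega))
    have hdown : ∀ d i, p (i + d) ∈ S → 3 ≤ i → i + d ≤ r → p i ∈ S := by
      intro d
      induction d with
      | zero => intro i hi _ _; exact hi
      | succ d ih =>
        intro i hi h3 hir
        refine ih i ?_ h3 (by omega)
        by_contra hn
        exact hno _ hi _ hn (hbig _ (by omega) (by omega)) (hadj (i + d) (by omega)).symm
    obtain ⟨i, hi, rfl⟩ := hspan z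
    have hi3 : 3 ≤ i := by
      have h0 : i ≠ 0 := fun e => hSX _ hz (by simp [e, p0])
      have h1 : i ≠ 1 := fun e => hvS (by rwa [← p1, ← e])
      have h2 : i ≠ 2 := fun e => hSX _ hz (by simp [e, p2])
      omega
    have hsS : p s ∈ S := by
      rcases le_total i s with his | his
      · exact hup i hz s his hi3 hs
      · exact hdown (i - s) s (by rwa [Nat.add_sub_cancel' his]) hs3 (by omega)
    refine hno _ hsS v hvS ?_ hq
    rintro (e | e)
    · exact h.irrefl _ (e ▸ hy)
    · exact h.irrefl _ (e ▸ hx))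
  exact hxy (h.in_injective hβ hx hy (by rw [hβα x (by simp), hβα y (by simp)]))

theorem in_iff_of_adj (h : Stuck A k) (hk : 2 ≤ k) {v x y : W}
    (hq : ∀ q, Adj A q v → q = x ∨ q = y) (q : W) : A q v ↔ q = x ∨ q = y := by
  refine ⟨fun hA => hq q (Or.inl hA), ?_⟩
  rintro (rfl | rfl)
  · obtain ⟨w, hw, hne⟩ := h.exists_in_ne hk v y
    rwa [(hq w (Or.inl hw)).resolve_right hne] at hw
  · obtain ⟨w, hw, hne⟩ := h.exists_in_ne hk v x
    rwa [(hq w (Or.inl hw)).resolve_left hne] at hw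

theorem thin_of_not_digon (h : Stuck A k) (hk : 2 ≤ k) {v x y : W} (hxy : x ≠ y)
    (hnot : ¬ (A x y ∧ A y x)) (hv : (A x v ∧ A y v) ∨ (A v x ∧ A v y)) : Thin A v x y := by
  have hq : ∀ q, Adj A q v → q = x ∨ q = y := by
    intro q hq
    rcases hv with ⟨hx, hy⟩ | ⟨hx, hy⟩
    · by_cases hA : A x y
      · exact (h.eq_or_eq_of_not_arc hk hxy.symm hy hx (fun h' => hnot ⟨hA, h'⟩) hq).symm
      · exact h.eq_or_eq_of_not_arc hk hxy hx hy hA hq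
    · by_cases hA : A x y
      · exact h.reverse.eq_or_eq_of_not_arc hk hxy hx hy (fun h' => hnot ⟨hA, h'⟩) hq.symm
      · exact (h.reverse.eq_or_eq_of_not_arc hk hxy.symm hy hx hA hq.symm).symm
  exact ⟨hxy, hnot, h.in_iff_of_adj hk hq,
    h.reverse.in_iff_of_adj hk fun q h' => hq q h'.of_rev⟩

theorem thin_neighbour (h : Stuck A k) (hk : 2 ≤ k) {v x y : W} (t : Thin A v x y) :
    ∃ x' y', Thin A x x' y' := by
  have hxv : A x v := (t.in_iff x).2 (Or.inl rfl)
  have hvx : A v x := (t.out_iff x).2 (Or.inl rfl)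
  obtain ⟨a, ha, hav⟩ := h.exists_in_ne hk x v
  obtain ⟨b, hb, hbv⟩ := h.reverse.exists_in_ne hk x v
  have hax : a ≠ x := fun e => h.irrefl x (e ▸ ha)
  have hbx : b ≠ x := fun e => h.irrefl b (e ▸ hb)
  by_cases hay : a = y
  · have hby : b ≠ y := fun e => t.not_digon ⟨e ▸ hb, hay ▸ ha⟩
    exact ⟨v, b, h.thin_of_not_digon hk hbv.symm
      (fun h' => ((t.in_iff b).1 h'.2).elim hbx hby) (Or.inr ⟨hxv, hb⟩)⟩
  · exact ⟨v, a, h.thin_of_not_digon hk hav.symm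
      (fun h' => ((t.in_iff a).1 h'.2).elim hax hay) (Or.inl ⟨hvx, ha⟩)⟩

theorem complete_of_digon (h : Stuck A k) (hk : 2 ≤ k)
    (hdig : ∀ v x y, x ≠ y → (A x v ∧ A y v) ∨ (A v x ∧ A v y) → A x y) {u v : W} (huv : u ≠ v) :
    A u v := by
  have hsymm : ∀ v w, A v w → A w v := by
    intro v w hvw
    obtain ⟨u, hu, hne⟩ := h.reverse.exists_in_ne hk v w
    have hwu : A w u := hdig v w u hne.symm (Or.inr ⟨hvw, hu⟩)
    exact hdig u w v (fun e => h.irrefl v (e ▸ hvw)) (Or.inl ⟨hwu, hu⟩)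
  by_contra hnot
  obtain ⟨w, hw, z, hz, ha⟩ := h.conn {w | w = u ∨ A u w} ⟨u, Or.inl rfl⟩
    ⟨v, by rintro (e | e); exacts [huv e.symm, hnot e]⟩
  have hwz : A w z := ha.elim id (hsymm z w)
  apply hz
  rcases hw with rfl | hw
  · exact Or.inr hwz
  · by_cases hzu : z = u
    · exact Or.inl hzu
    · exact Or.inr (hdig w u z (Ne.symm hzu) (Or.inr ⟨hsymm u w hw, hwz⟩))

/-- A connected digraph with degrees at most `k ≥ 2` and no `k`-dicolouring is a bidirected
complete graph or a bidirected odd cycle. -/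
theorem complete_or_odd_cycle (h : Stuck A k) (hk : 2 ≤ k) :
    (∀ u v, u ≠ v → A u v) ∨
      ((∀ u v, A u v → A v u) ∧ (∀ v, ∃ x y, x ≠ y ∧ ∀ q, A q v ↔ q = x ∨ q = y) ∧
        Odd (Fintype.card W)) := by
  by_cases hdig : ∀ v x y, x ≠ y → (A x v ∧ A y v) ∨ (A v x ∧ A v y) → A x y
  · exact Or.inl fun u v => h.complete_of_digon hk hdig
  right
  push Not at hdig
  obtain ⟨v₀, x₀, y₀, hne₀, hv₀, hnot₀⟩ := hdig
  have t₀ := h.thin_of_not_digon hk hne₀ (fun h' => hnot₀ h'.1) hv₀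
  have hall : ∀ v, ∃ x y, Thin A v x y := by
    by_contra! hno
    obtain ⟨z, hz⟩ := hno
    obtain ⟨u, ⟨x, y, t⟩, w, hw, ha⟩ := h.conn {v | ∃ x y, Thin A v x y} ⟨v₀, x₀, y₀, t₀⟩
      ⟨z, fun ⟨x, y, t⟩ => hz x y t⟩
    apply hw
    rcases ha.elim (t.out_iff w).1 (t.in_iff w).1 with rfl | rfl
    · exact h.thin_neighbour hk t
    · exact h.thin_neighbour hk t.symm
  refine ⟨fun u v huv => ?_, fun v => ?_, ?_⟩
  · obtain ⟨x, y, t⟩ := hall v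
    exact (t.out_iff u).2 ((t.in_iff u).1 huv)
  · obtain ⟨x, y, t⟩ := hall v
    exact ⟨x, y, t.ne, t.in_iff⟩
  · obtain ⟨p, r, -, -, -, -, -, -, -, c, L, hc, hspan⟩ := h.exists_spanning_path hk
      (Or.inl ((t₀.in_iff x₀).2 (Or.inl rfl))) (Or.inl ((t₀.out_iff y₀).2 (Or.inr rfl))) hne₀
    have hL := hc.three_le
    obtain ⟨x, y, t⟩ := hall (c 0)
    have hnbr : ∀ q, Adj A q (c 0) → q = x ∨ q = y := fun q hq =>
      hq.elim (t.in_iff q).1 (t.out_iff q).1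
    have hadj : ∀ q, Adj A q (c 0) → A q (c 0) := fun q hq => (t.in_iff q).2 (hnbr q hq)
    have h1 : Adj A (c 1) (c 0) := (hc.adj 0).symm
    have h2 : Adj A (c (L - 1)) (c 0) := by
      have := hc.adj (L - 1)
      rwa [Nat.sub_add_cancel (by omega), ← Nat.zero_add L, hc.period, Nat.zero_add] at this
    have hodd := h.odd_of_two_in hc (fun i hi hiL ha => by
      have hne : c 1 ≠ c (L - 1) := fun e => by
        have := hc.eq_of_lt (by omega) (by omega) e
        omega
      have : c i = c 1 ∨ c i = c (L - 1) := by
        rcases hnbr _ ha with e | e <;> rcases hnbr _ h1 with e1 | e1 <;>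
          rcases hnbr _ h2 with e2 | e2 <;> simp_all
      rcases this with e | e
      · exact Or.inl (hc.eq_of_lt hiL (by omega) e)
      · exact Or.inr (hc.eq_of_lt hiL (by omega) e)) (hadj _ h1) (hadj _ h2)
    have hcard : Fintype.card (Fin L) = Fintype.card W := by
      apply Fintype.card_of_bijective (f := fun i : Fin L => c i)
      refine ⟨fun i j e => Fin.ext (hc.eq_of_lt i.2 j.2 e), fun u => ?_⟩
      obtain ⟨i, hi, e⟩ := hc.exists_lt (hspan u)
      exact ⟨⟨i, hi⟩, e.symm⟩
    rwa [← hcard, Fintype.card_fin]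

end Stuck

end DirectedBrooks

namespace Digraph'

variable {D : Digraph'} {k : ℕ}

/-- The maximum of all in- and out-degrees of `D`. -/
abbrev maxDeg (D : Digraph') : ℕ := D.verts.sup fun v => max (D.outDeg v) (D.inDeg v)

/-- The arc relation of `D` on its vertex subtype. -/
def arcRel (D : Digraph') (u v : D.verts) : Prop := (u.1, v.1) ∈ D.arcs

theorem arcRel_irrefl (D : Digraph') (v : D.verts) : ¬ D.arcRel v v :=
  fun h => D.no_loops _ h rfl

theorem mem_inNbrs {u v : ℕ} : u ∈ D.inNbrs v ↔ (u, v) ∈ D.arcs := by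
  simp [inNbrs]

theorem mem_outNbrs {u v : ℕ} : u ∈ D.outNbrs v ↔ (v, u) ∈ D.arcs := by
  simp [outNbrs]

theorem card_inNbrs (D : Digraph') (v : ℕ) : (D.inNbrs v).card = D.inDeg v := by
  refine Finset.card_image_of_injOn fun a ha b hb h => ?_
  simp only [Finset.coe_filter, Set.mem_ofPred_eq] at ha hb
  exact Prod.ext h (ha.2.trans hb.2.symm)

theorem card_outNbrs (D : Digraph') (v : ℕ) : (D.outNbrs v).card = D.outDeg v := by
  refine Finset.card_image_of_injOn fun a ha b hb h => ?_
  simp only [Finset.coe_filter, Set.mem_ofPred_eq] at ha hb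
  exact Prod.ext (ha.2.trans hb.2.symm) h

theorem inDeg_le_maxDeg {v : ℕ} (hv : v ∈ D.verts) : D.inDeg v ≤ D.maxDeg :=
  (le_max_right _ _).trans
    (Finset.le_sup (f := fun v => max (D.outDeg v) (D.inDeg v)) hv)

theorem outDeg_le_maxDeg {v : ℕ} (hv : v ∈ D.verts) : D.outDeg v ≤ D.maxDeg :=
  (le_max_left _ _).trans
    (Finset.le_sup (f := fun v => max (D.outDeg v) (D.inDeg v)) hv)

theorem maxDeg_eq {d : ℕ} (hne : D.verts.Nonempty)
    (h : ∀ v ∈ D.verts, D.inDeg v = d ∧ D.outDeg v = d) : D.maxDeg = d := by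
  obtain ⟨v, hv⟩ := hne
  refine le_antisymm (Finset.sup_le fun w hw => ?_) ((h v hv).1 ▸ inDeg_le_maxDeg hv)
  rw [(h w hw).1, (h w hw).2, max_self]

theorem card_arcRel_in_le (D : Digraph') (v : D.verts) :
    (Finset.univ.filter fun u => D.arcRel u v).card ≤ D.maxDeg := by
  refine le_trans ?_ (inDeg_le_maxDeg v.2)
  rw [← card_inNbrs]
  refine Finset.card_le_card_of_injOn Subtype.val (fun u hu => ?_) Subtype.val_injective.injOn
  exact Finset.mem_coe.2 (mem_inNbrs.2 (Finset.mem_filter.1 (Finset.mem_coe.1 hu)).2)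

theorem card_arcRel_out_le (D : Digraph') (v : D.verts) :
    (Finset.univ.filter fun u => D.arcRel v u).card ≤ D.maxDeg := by
  refine le_trans ?_ (outDeg_le_maxDeg v.2)
  rw [← card_outNbrs]
  refine Finset.card_le_card_of_injOn Subtype.val (fun u hu => ?_) Subtype.val_injective.injOn
  exact Finset.mem_coe.2 (mem_outNbrs.2 (Finset.mem_filter.1 (Finset.mem_coe.1 hu)).2)

theorem Connected.subset_of_closed (hD : D.Connected) {S : Set ℕ} {u : ℕ} (hu : u ∈ D.verts)
    (huS : u ∈ S) (hS : ∀ v ∈ S, ∀ w, D.ugAdj v w → w ∈ S) : ∀ v ∈ D.verts, v ∈ S := by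
  intro v hv
  have := hD.2 u hu v hv
  induction this with
  | refl => exact huS
  | tail _ hbc ih => exact hS _ (ih hbc.1) _ hbc

theorem Connected.exists_adj_compl (hD : D.Connected) (S : Set D.verts) (hS : S.Nonempty)
    (hSc : Sᶜ.Nonempty) : ∃ u ∈ S, ∃ w ∈ Sᶜ, DirectedBrooks.Adj D.arcRel u w := by
  by_contra! hno
  obtain ⟨u, hu⟩ := hS
  obtain ⟨z, hz⟩ := hSc
  obtain ⟨_, h⟩ := hD.subset_of_closed (S := {v | ∃ h : v ∈ D.verts, (⟨v, h⟩ : D.verts) ∈ S})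
    u.2 ⟨u.2, hu⟩ (fun v hv w hvw => by
      obtain ⟨_, hv⟩ := hv
      refine ⟨hvw.2.1, ?_⟩
      by_contra hw
      exact hno _ hv ⟨w, hvw.2.1⟩ hw hvw.2.2) z z.2
  exact hz h

theorem IsDirectedCycle.exists_in {C : Digraph'} (hC : C.IsDirectedCycle) {v : ℕ}
    (hv : v ∈ C.verts) : ∃ u, (u, v) ∈ C.arcs := by
  have h := (hC.2 v hv).1
  rw [← card_inNbrs] at h
  obtain ⟨u, hu⟩ := Finset.card_pos.1 (by rw [h]; exact one_pos)
  exact ⟨u, mem_inNbrs.1 hu⟩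

theorem IsDirectedCycle.exists_out {C : Digraph'} (hC : C.IsDirectedCycle) {v : ℕ}
    (hv : v ∈ C.verts) : ∃ u, (v, u) ∈ C.arcs := by
  have h := (hC.2 v hv).2
  rw [← card_outNbrs] at h
  obtain ⟨u, hu⟩ := Finset.card_pos.1 (by rw [h]; exact one_pos)
  exact ⟨u, mem_outNbrs.1 hu⟩

theorem exists_isKDicolouring (hD : D.Connected) {β : D.verts → Fin k}
    (hβ : DirectedBrooks.Col D.arcRel Set.univ β) : ∃ α : ℕ → Fin k, D.IsKDicolouring k α := by
  obtain ⟨v₀, hv₀⟩ := hD.1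
  refine ⟨fun n => if h : n ∈ D.verts then β ⟨n, h⟩ else β ⟨v₀, hv₀⟩, fun i => ?_⟩
  rintro ⟨C, hsub, hC⟩
  have hmem : ∀ n ∈ C.verts, ∃ h : n ∈ D.verts, β ⟨n, h⟩ = i := by
    intro n hn
    have h := hsub.1 hn
    simp only [induce, Finset.mem_inter, Finset.mem_filter] at h
    have h2 := h.2.2
    rw [dif_pos h.1] at h2
    exact ⟨h.1, h2⟩
  have harc : ∀ a ∈ C.arcs, a ∈ D.arcs := fun a ha => (Finset.mem_filter.1 (hsub.2 ha)).1
  obtain ⟨n, hn⟩ := hC.1.1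
  obtain ⟨v, hv, hno⟩ := hβ i {x | x.1 ∈ C.verts}
    (fun x hx => ⟨Set.mem_univ _, (hmem x.1 hx).2⟩) ⟨⟨n, (hmem n hn).1⟩, hn⟩
  rcases hno with hno | hno
  · obtain ⟨u, hu⟩ := hC.exists_in hv
    have huC := C.mem_fst _ hu
    exact hno ⟨u, (hmem u huC).1⟩ huC (harc _ hu)
  · obtain ⟨u, hu⟩ := hC.exists_out hv
    have huC := C.mem_snd _ hu
    exact hno ⟨u, (hmem u huC).1⟩ huC (harc _ hu)

theorem Connected.exists_maxDeg_succ_dicolouring (hD : D.Connected) :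
    ∃ α : ℕ → Fin (D.maxDeg + 1), D.IsKDicolouring (D.maxDeg + 1) α := by
  obtain ⟨β, hβ⟩ := DirectedBrooks.exists_col_of_inDeg_lt D.arcRel_irrefl
    fun v => Nat.lt_succ_of_le (D.card_arcRel_in_le v)
  exact exists_isKDicolouring hD hβ

theorem Connected.dichromatic_le (hD : D.Connected) : D.dichromatic ≤ D.maxDeg + 1 :=
  Nat.sInf_le hD.exists_maxDeg_succ_dicolouring

theorem Connected.exists_dichromatic_dicolouring (hD : D.Connected) :
    ∃ α : ℕ → Fin D.dichromatic, D.IsKDicolouring D.dichromatic α :=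
  Nat.sInf_mem (s := {k : ℕ | ∃ α : ℕ → Fin k, D.IsKDicolouring k α})
    ⟨_, hD.exists_maxDeg_succ_dicolouring⟩

theorem Connected.bidirectedComplete_of_maxDeg_eq_zero (hD : D.Connected) (h : D.maxDeg = 0) :
    D.BidirectedComplete := by
  intro u hu v hv huv
  have harc : ∀ a, a ∉ D.arcs := by
    intro a ha
    have h1 := inDeg_le_maxDeg (D.mem_snd a ha)
    rw [h, Nat.le_zero, inDeg, Finset.card_eq_zero] at h1
    exact Finset.notMem_empty a (h1 ▸ Finset.mem_filter.2 ⟨ha, rfl⟩)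
  exact (huv (hD.subset_of_closed (S := {u}) hu rfl
    (fun _ _ _ h => h.2.2.elim (fun h => (harc _ h).elim) fun h => (harc _ h).elim) v hv).symm).elim

theorem IsSubdigraph.inNbrs_subset {C : Digraph'} (h : C.IsSubdigraph D) (v : ℕ) :
    C.inNbrs v ⊆ D.inNbrs v :=
  fun _ hu => mem_inNbrs.2 (h.2 (mem_inNbrs.1 hu))

theorem IsSubdigraph.outNbrs_subset {C : Digraph'} (h : C.IsSubdigraph D) (v : ℕ) :
    C.outNbrs v ⊆ D.outNbrs v :=
  fun _ hu => mem_outNbrs.2 (h.2 (mem_outNbrs.1 hu))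

theorem Connected.isDirectedCycle_of_maxDeg_eq_one (hD : D.Connected) (h : D.maxDeg = 1)
    (hno : ¬ ∃ α : ℕ → Fin 1, D.IsKDicolouring 1 α) : D.IsDirectedCycle := by
  have hcyc : ∃ C : Digraph', C.IsSubdigraph D ∧ C.IsDirectedCycle := by
    by_contra hC
    refine hno ⟨fun _ => 0, fun i => ?_⟩
    rintro ⟨C, hsub, hcyc⟩
    exact hC ⟨C, ⟨fun v hv => (Finset.mem_inter.1 (hsub.1 hv)).1,
      fun a ha => (Finset.mem_filter.1 (hsub.2 ha)).1⟩, hcyc⟩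
  obtain ⟨C, hsub, hC⟩ := hcyc
  have hin : ∀ v ∈ C.verts, C.inNbrs v = D.inNbrs v := fun v hv =>
    Finset.eq_of_subset_of_card_le (hsub.inNbrs_subset v) (by
      rw [card_inNbrs, card_inNbrs, (hC.2 v hv).1, ← h]
      exact inDeg_le_maxDeg (hsub.1 hv))
  have hout : ∀ v ∈ C.verts, C.outNbrs v = D.outNbrs v := fun v hv =>
    Finset.eq_of_subset_of_card_le (hsub.outNbrs_subset v) (by
      rw [card_outNbrs, card_outNbrs, (hC.2 v hv).2, ← h]
      exact outDeg_le_maxDeg (hsub.1 hv))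
  obtain ⟨u, hu⟩ := hC.1.1
  have hall : ∀ v ∈ D.verts, v ∈ C.verts :=
    hD.subset_of_closed (S := {v | v ∈ C.verts}) (hsub.1 hu) hu fun v hv w hvw => by
      rcases hvw.2.2 with ha | ha
      · rw [← mem_outNbrs, ← hout v hv, mem_outNbrs] at ha
        exact C.mem_snd _ ha
      · rw [← mem_inNbrs, ← hin v hv, mem_inNbrs] at ha
        exact C.mem_fst _ ha
  refine ⟨hD, fun v hv => ?_⟩
  rw [← card_inNbrs, ← card_outNbrs, ← hin v (hall v hv), ← hout v (hall v hv), card_inNbrs,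
    card_outNbrs]
  exact hC.2 v (hall v hv)

theorem Connected.complete_or_oddCycle_of_two_le (hD : D.Connected) (h : 2 ≤ D.maxDeg)
    (hno : ¬ ∃ α : ℕ → Fin D.maxDeg, D.IsKDicolouring D.maxDeg α) :
    D.BidirectedOddCycle ∨ D.BidirectedComplete := by
  have hstuck : DirectedBrooks.Stuck D.arcRel D.maxDeg :=
    { irrefl := D.arcRel_irrefl
      in_le := D.card_arcRel_in_le
      out_le := D.card_arcRel_out_le
      conn := hD.exists_adj_compl
      not_col := fun ⟨_, hβ⟩ => hno (exists_isKDicolouring hD hβ)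
      pos := by omega }
  rcases hstuck.complete_or_odd_cycle h with hc | ⟨hsymm, hdeg, hodd⟩
  · exact Or.inr fun u hu v hv huv =>
      hc ⟨u, hu⟩ ⟨v, hv⟩ fun e => huv (congrArg Subtype.val e)
  · have hbi : D.Bidirected := fun a ha =>
      hsymm ⟨a.1, D.mem_fst a ha⟩ ⟨a.2, D.mem_snd a ha⟩ ha
    refine Or.inl ⟨hbi, ⟨hD, fun v hv => ?_⟩, by rwa [Fintype.card_coe] at hodd⟩
    obtain ⟨x, y, hxy, hq⟩ := hdeg ⟨v, hv⟩
    rw [Finset.card_eq_two]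
    refine ⟨x, y, fun e => hxy (Subtype.ext e), ?_⟩
    ext q
    have hiff : (q, v) ∈ D.arcs ↔ q = x ∨ q = y := by
      constructor
      · intro hqv
        exact ((hq ⟨q, D.mem_fst _ hqv⟩).1 hqv).imp (congrArg Subtype.val) (congrArg Subtype.val)
      · rintro (rfl | rfl)
        exacts [(hq x).2 (Or.inl rfl), (hq y).2 (Or.inr rfl)]
    rw [ugNbrs, Finset.mem_union, mem_inNbrs, mem_outNbrs, Finset.mem_insert,
      Finset.mem_singleton, ← hiff, or_iff_left_of_imp (hbi (v, q))]

/-- The digraph consisting of two vertices joined by arcs in both directions. -/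
def digon (u v : ℕ) (h : u ≠ v) : Digraph' where
  verts := {u, v}
  arcs := {(u, v), (v, u)}
  mem_fst := by simp
  mem_snd := by simp
  no_loops := by simp [h, h.symm]

theorem digon_isDirectedCycle {u v : ℕ} (h : u ≠ v) : (digon u v h).IsDirectedCycle := by
  have huv : (digon u v h).ugAdj u v := by simp [ugAdj, digon]
  have hvu : (digon u v h).ugAdj v u := by simp [ugAdj, digon]
  refine ⟨⟨⟨u, by simp [digon]⟩, ?_⟩, ?_⟩
  · simp only [digon, Finset.mem_insert, Finset.mem_singleton]
    rintro a (rfl | rfl) b (rfl | rfl)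
    exacts [.refl, .single huv, .single hvu, .refl]
  · simp only [digon, Finset.mem_insert, Finset.mem_singleton, inDeg, outDeg]
    rintro a (rfl | rfl) <;> simp [Finset.filter_insert, Finset.filter_singleton, h, h.symm]

theorem IsKDicolouring.ne_of_digon {α : ℕ → Fin k} (hα : D.IsKDicolouring k α) {u v : ℕ}
    (huv : (u, v) ∈ D.arcs) (hvu : (v, u) ∈ D.arcs) : α u ≠ α v := by
  intro he
  have hu := D.mem_fst _ huv
  have hv := D.mem_snd _ huv
  refine hα (α v) ⟨digon u v (D.no_loops _ huv), ⟨?_, ?_⟩, digon_isDirectedCycle _⟩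
  · intro w hw
    simp only [digon, Finset.mem_insert, Finset.mem_singleton] at hw
    rcases hw with rfl | rfl <;> simp_all [induce]
  · intro a ha
    simp only [digon, Finset.mem_insert, Finset.mem_singleton] at ha
    rcases ha with rfl | rfl <;> simp_all [induce]

theorem IsDirectedCycle.two_le_of_isKDicolouring (hC : D.IsDirectedCycle) {α : ℕ → Fin k}
    (hα : D.IsKDicolouring k α) : 2 ≤ k := by
  by_contra hk
  have : Subsingleton (Fin k) := Fin.subsingleton_iff_le_one.2 (by omega)
  refine hα (α 0) ⟨D, ⟨fun v hv => ?_, fun a ha => ?_⟩, hC⟩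
  · simp [induce, hv, Subsingleton.elim (α v) (α 0)]
  · simp [induce, ha, D.mem_fst a ha, D.mem_snd a ha, Subsingleton.elim (α _) (α 0)]

theorem BidirectedComplete.card_le_of_isKDicolouring (hC : D.BidirectedComplete)
    {α : ℕ → Fin k} (hα : D.IsKDicolouring k α) : D.verts.card ≤ k := by
  have h := Finset.card_le_card_of_injOn (s := D.verts) (t := Finset.univ) α (by simp)
    fun u hu v hv he => by
      by_contra hne
      exact hα.ne_of_digon (hC u hu v hv hne) (hC v hv u hu (Ne.symm hne)) he
  simpa using h

theorem BidirectedComplete.maxDeg_succ (hC : D.BidirectedComplete) (hne : D.verts.Nonempty) :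
    D.maxDeg + 1 = D.verts.card := by
  have hdeg : D.maxDeg = D.verts.card - 1 := by
    refine maxDeg_eq hne fun v hv => ?_
    rw [← card_inNbrs, ← card_outNbrs, ← Finset.card_erase_of_mem hv]
    constructor <;> congr 1 <;> ext u <;> rw [Finset.mem_erase]
    · rw [mem_inNbrs]
      exact ⟨fun h => ⟨D.no_loops _ h, D.mem_fst _ h⟩, fun h => hC u h.2 v hv h.1⟩
    · rw [mem_outNbrs]
      exact ⟨fun h => ⟨(D.no_loops _ h).symm, D.mem_snd _ h⟩, fun h => hC v hv u h.2 h.1.symm⟩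
  have := hne.card_pos
  omega

theorem BidirectedOddCycle.degrees (hC : D.BidirectedOddCycle) {v : ℕ} (hv : v ∈ D.verts) :
    D.inDeg v = 2 ∧ D.outDeg v = 2 := by
  have h : D.inNbrs v = D.outNbrs v := by
    ext u
    rw [mem_inNbrs, mem_outNbrs]
    exact ⟨hC.1 (u, v), hC.1 (v, u)⟩
  have h2 := hC.2.1.2 v hv
  rw [ugNbrs, h, Finset.union_self] at h2
  exact ⟨by rw [← card_inNbrs, h, h2], by rw [← card_outNbrs, h2]⟩

theorem BidirectedOddCycle.three_le_of_isKDicolouring (hC : D.BidirectedOddCycle)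
    {α : ℕ → Fin k} (hα : D.IsKDicolouring k α) : 3 ≤ k := by
  by_contra hk
  have hne : ∀ a ∈ D.arcs, ((α a.1).1 = 0 ↔ ¬ (α a.2).1 = 0) := by
    intro a ha
    have h := hα.ne_of_digon (u := a.1) (v := a.2) ha (hC.1 a ha)
    rw [Ne, Fin.ext_iff] at h
    have := (α a.1).2
    have := (α a.2).2
    omega
  have hfst : (D.arcs.filter fun a => (α a.1).1 = 0).card =
      (D.verts.filter fun v => (α v).1 = 0).card * 2 := by
    refine Finset.card_eq_sum_card_fiberwise (f := Prod.fst)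
      (t := D.verts.filter fun v => (α v).1 = 0) (fun a ha => ?_) |>.trans ?_
    · simp only [Finset.coe_filter, Set.mem_ofPred_eq] at ha ⊢
      exact ⟨D.mem_fst a ha.1, ha.2⟩
    · refine Finset.sum_const_nat fun v hv => ?_
      rw [Finset.mem_filter] at hv
      rw [← (hC.degrees hv.1).2, outDeg, Finset.filter_filter]
      congr 1
      refine Finset.filter_congr fun a _ => ⟨fun h => h.2, fun h => ⟨h ▸ hv.2, h⟩⟩
  have hsnd : (D.arcs.filter fun a => (α a.1).1 = 0).card =
      (D.verts.filter fun v => ¬ (α v).1 = 0).card * 2 := by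
    refine Finset.card_eq_sum_card_fiberwise (f := Prod.snd)
      (t := D.verts.filter fun v => ¬ (α v).1 = 0) (fun a ha => ?_) |>.trans ?_
    · simp only [Finset.coe_filter, Set.mem_ofPred_eq] at ha ⊢
      exact ⟨D.mem_snd a ha.1, (hne a ha.1).1 ha.2⟩
    · refine Finset.sum_const_nat fun v hv => ?_
      rw [Finset.mem_filter] at hv
      rw [← (hC.degrees hv.1).1, inDeg, Finset.filter_filter]
      congr 1
      exact Finset.filter_congr fun a ha => ⟨fun h => h.2, fun h => ⟨(hne a ha).2 (h ▸ hv.2), h⟩⟩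
  have hsum := Finset.card_filter_add_card_filter_not (s := D.verts) fun v => (α v).1 = 0
  obtain ⟨m, hm⟩ := hC.2.2
  omega

end Digraph'

/-- **Theorem (directed Brooks, Mohar).** Let `D` be a connected digraph. Then
`χ⃗(D) ≤ max_v max(d⁺(v), d⁻(v)) + 1`, with equality iff `D` is a directed cycle, a
bidirected odd cycle, or a bidirected complete graph. -/
theorem directed_brooks
    (D : Digraph') (hconn : D.Connected) :
    D.dichromatic ≤ (D.verts.sup fun v => max (D.outDeg v) (D.inDeg v)) + 1 ∧
    (D.dichromatic = (D.verts.sup fun v => max (D.outDeg v) (D.inDeg v)) + 1 ↔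
      D.IsDirectedCycle ∨ D.BidirectedOddCycle ∨ D.BidirectedComplete) := by
  refine ⟨hconn.dichromatic_le, fun heq => ?_, fun h => hconn.dichromatic_le.antisymm ?_⟩
  · have hno : ¬ ∃ α : ℕ → Fin D.maxDeg, D.IsKDicolouring D.maxDeg α := fun h => by
      have hle : D.dichromatic ≤ D.maxDeg := Nat.sInf_le h
      exact absurd (heq.symm.le.trans hle) (Nat.not_succ_le_self _)
    rcases Nat.lt_or_ge D.maxDeg 2 with hlt | hge
    · obtain h0 | h1 : D.maxDeg = 0 ∨ D.maxDeg = 1 := by omega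
      · exact Or.inr (Or.inr (hconn.bidirectedComplete_of_maxDeg_eq_zero h0))
      · exact Or.inl (hconn.isDirectedCycle_of_maxDeg_eq_one h1 (by rwa [h1] at hno))
    · exact Or.inr (hconn.complete_or_oddCycle_of_two_le hge hno)
  · change D.maxDeg + 1 ≤ _
    obtain ⟨α, hα⟩ := hconn.exists_dichromatic_dicolouring
    rcases h with h | h | h
    · rw [maxDeg_eq hconn.1 h.2]
      exact h.two_le_of_isKDicolouring hα
    · rw [maxDeg_eq hconn.1 fun v hv => h.degrees hv]
      exact h.three_le_of_isKDicolouring hα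
    · rw [h.maxDeg_succ hconn.1]
      exact h.card_le_of_isKDicolouring hα
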